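/- arXiv:1810.12115 — 2 statements merged into one kernel-verified Lean document; each statement's English description precedes it below -/
import Mathlib

section
/- For all integers p, q and r, the Fibonacci and Lucas numbers satisfy 5 F_{p+q+r} = L_{q-1} L_r F_{p-1} + (L_{q+1} L_r + L_{q-1} L_{r-1}) F_p + L_q L_{r+1} F_{p+1}. -/
/-- Fibonacci numbers extended to all integer indices:
`F 0 = 0`, `F 1 = 1`, `F n = F (n-1) + F (n-2)` for all `n : ℤ`
(equivalently `F (-n) = (-1)^(n-1) * F n`). -/
def fibZ (n : ℤ) : ℤ :=
  if 0 ≤ n then Nat.fib n.toNat else (-1) ^ (n.natAbs + 1) * Nat.fib n.natAbs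

/-- Lucas numbers extended to all integer indices:
`L 0 = 2`, `L 1 = 1`, `L n = L (n-1) + L (n-2)` for all `n : ℤ`
(equivalently `L (-n) = (-1)^n * L n`). -/
def lucasZ (n : ℤ) : ℤ := fibZ (n - 1) + fibZ (n + 1)

theorem fibZ_eq_fib (n : ℤ) : fibZ n = Int.fib n := by
  unfold fibZ
  split_ifs with h
  · rw [Int.fib_of_nonneg h]
  · obtain ⟨k, rfl⟩ : ∃ k : ℕ, n = -k := ⟨n.natAbs, by omega⟩
    rw [Int.fib_neg_natCast]
    simp

theorem fibZ_add (m n : ℤ) :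
    fibZ (m + n) = fibZ (m - 1) * fibZ n + fibZ m * fibZ (n + 1) := by
  simp only [fibZ_eq_fib]
  exact Int.fib_add m n

theorem fibZ_step (n : ℤ) : fibZ (n + 1) = fibZ (n - 1) + fibZ n := by
  have h := Int.fib_add_two (n - 1)
  simp only [fibZ_eq_fib]
  rw [show n - 1 + 2 = n + 1 by ring, show n - 1 + 1 = n by ring] at h
  exact h

theorem five_fib_triple_addition (p q r : ℤ) :
    5 * fibZ (p + q + r) =
      lucasZ (q - 1) * lucasZ r * fibZ (p - 1) +
        (lucasZ (q + 1) * lucasZ r + lucasZ (q - 1) * lucasZ (r - 1)) * fibZ p +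
        lucasZ q * lucasZ (r + 1) * fibZ (p + 1) := by
  have e1 : fibZ (p + q + r) = fibZ (p - 1) * fibZ (q + r) + fibZ p * fibZ (q + (r + 1)) := by
    rw [add_assoc, fibZ_add, add_assoc q r 1]
  have a (n : ℤ) : fibZ (n + 1) = fibZ (n - 1) + fibZ n := fibZ_step n
  have b (n : ℤ) : fibZ (n - 1 - 1) = fibZ n - fibZ (n - 1) := by
    have h := a (n - 1)
    rw [sub_add_cancel] at h
    linarith
  have c (n : ℤ) : fibZ (n + 1 + 1) = fibZ n + fibZ (n + 1) := by
    have h := a (n + 1)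
    rwa [add_sub_cancel_right] at h
  rw [e1, fibZ_add q r, fibZ_add q (r + 1)]
  simp only [lucasZ, sub_add_cancel, add_sub_cancel_right, c, b, a]
  ring
end

section
/- For every positive integer n and all integers k, t and s, the Fibonacci and Lucas numbers satisfy ∑_{j=0}^{n} (-1)^{tj} C(n,j) · F_k^j · F_t^{n-j} · L_{(s+k)n-(t+k)j} = F_{t+k}^n · L_{sn}. -/
open Real in
theorem binetZ (n : ℤ) : (fibZ n : ℝ) = (goldenRatio ^ n - goldenConj ^ n) / √5 := by
  unfold fibZ
  split_ifs with h
  · obtain ⟨m, rfl⟩ := Int.eq_ofNat_of_zero_le h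
    simp [Real.coe_fib_eq]
  · obtain ⟨m, hm⟩ := Int.eq_ofNat_of_zero_le (show 0 ≤ -n by omega)
    obtain rfl : n = -(m : ℤ) := by omega
    have h1 : (goldenRatio : ℝ)⁻¹ = -goldenConj := Real.inv_goldenRatio
    have h2 : (goldenConj : ℝ)⁻¹ = -goldenRatio := Real.inv_goldenConj
    simp only [Int.natAbs_neg, Int.natAbs_natCast, zpow_neg, zpow_natCast, ← inv_pow, h1, h2]
    push_cast
    rw [Real.coe_fib_eq, neg_pow goldenConj, neg_pow goldenRatio]
    ring

open Real in
theorem lucasZ_binet (n : ℤ) : (lucasZ n : ℝ) = goldenRatio ^ n + goldenConj ^ n := by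
  unfold lucasZ
  push_cast
  have h1 : (goldenRatio : ℝ)⁻¹ = -goldenConj := Real.inv_goldenRatio
  have h2 : (goldenConj : ℝ)⁻¹ = -goldenRatio := Real.inv_goldenConj
  have h3 : goldenRatio - goldenConj = √5 := Real.goldenRatio_sub_goldenConj
  have h5 : (√5 : ℝ) ≠ 0 := by positivity
  rw [binetZ, binetZ, zpow_sub_one₀ goldenRatio_ne_zero, zpow_sub_one₀ goldenConj_ne_zero,
    zpow_add_one₀ goldenRatio_ne_zero, zpow_add_one₀ goldenConj_ne_zero, h1, h2,
    ← add_div, div_eq_iff h5, ← h3]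
  ring

theorem key_sum (x y A B C e : ℝ) (n : ℕ) (k t s : ℤ) (hx : x ≠ 0)
    (H : B * x ^ k + e ^ t * A * x ^ (-t) = C) :
    ∑ j ∈ Finset.range (n + 1), e ^ (t * (j : ℤ)) * (n.choose j : ℝ) * A ^ j *
        B ^ (n - j) * x ^ ((s + k) * (n : ℤ) - (t + k) * (j : ℤ)) = C ^ n * x ^ (s * (n : ℤ)) := by
  rw [zpow_mul, zpow_natCast, ← mul_pow, ← H,
    show (B * x ^ k + e ^ t * A * x ^ (-t)) * x ^ s
      = (e ^ t * A * x ^ (s - t)) + B * x ^ (s + k) by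
        rw [sub_eq_add_neg, zpow_add₀ hx, zpow_add₀ hx]; ring, add_pow]
  refine Finset.sum_congr rfl fun j hj => ?_
  have hj' : j ≤ n := by simpa [Nat.lt_succ_iff] using hj
  have : x ^ ((s + k) * (n : ℤ) - (t + k) * (j : ℤ))
      = (x ^ (s - t)) ^ j * (x ^ (s + k)) ^ (n - j) := by
    rw [← zpow_natCast, ← zpow_natCast, ← zpow_mul, ← zpow_mul, ← zpow_add₀ hx]
    congr 1
    push_cast [hj']
    ring
  rw [this, zpow_mul, zpow_natCast]
  simp only [mul_pow]
  ring

theorem lucas_binomial_signed_sum (n : ℕ) (hn : 0 < n) (k t s : ℤ) :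
    ∑ j ∈ Finset.range (n + 1),
      (((-1 : ℤˣ) ^ (t * (j : ℤ)) : ℤˣ) : ℤ) * (n.choose j : ℤ) * fibZ k ^ j *
        fibZ t ^ (n - j) * lucasZ ((s + k) * (n : ℤ) - (t + k) * (j : ℤ))
      = fibZ (t + k) ^ n * lucasZ (s * (n : ℤ)) := by
  have h5 : (√5 : ℝ) ≠ 0 := by positivity
  have a0 := Real.goldenRatio_ne_zero
  have b0 := Real.goldenConj_ne_zero
  have hm : (-1 : ℝ) = Real.goldenRatio * Real.goldenConj := Real.goldenRatio_mul_goldenConj.symm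
  have H1 := key_sum Real.goldenRatio 0 (fibZ k) (fibZ t) (fibZ (t + k)) (-1) n k t s a0 (by
    have := zpow_ne_zero t a0
    rw [binetZ, binetZ, binetZ, hm, mul_zpow, zpow_add₀ a0, zpow_add₀ b0, zpow_neg]
    field_simp
    ring)
  have H2 := key_sum Real.goldenConj 0 (fibZ k) (fibZ t) (fibZ (t + k)) (-1) n k t s b0 (by
    have := zpow_ne_zero t b0
    rw [binetZ, binetZ, binetZ, hm, mul_zpow, zpow_add₀ a0, zpow_add₀ b0, zpow_neg]
    field_simp
    ring)
  have he : ∀ m : ℤ, ((((-1 : ℤˣ) ^ m : ℤˣ) : ℤ) : ℝ) = (-1 : ℝ) ^ m := by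
    intro m
    rcases Int.even_or_odd m with h | h
    · rw [h.neg_one_zpow, h.neg_one_zpow]; simp
    · rw [h.neg_one_zpow, Odd.neg_one_zpow h]; simp
  have : ((∑ j ∈ Finset.range (n + 1),
      (((-1 : ℤˣ) ^ (t * (j : ℤ)) : ℤˣ) : ℤ) * (n.choose j : ℤ) * fibZ k ^ j *
        fibZ t ^ (n - j) * lucasZ ((s + k) * (n : ℤ) - (t + k) * (j : ℤ)) : ℤ) : ℝ)
      = ((fibZ (t + k) ^ n * lucasZ (s * (n : ℤ)) : ℤ) : ℝ) := by
    simp only [Int.cast_sum, Int.cast_mul, Int.cast_pow, Int.cast_natCast, he, lucasZ_binet,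
      mul_add (_ * _), mul_add (_ ^ _), Finset.sum_add_distrib] at *
    rw [← H1, ← H2]
  exact_mod_cast this
end
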